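/- For each nonnegative integer ℓ, define P_{ℓ,n}(z) := ((-1)^n (q^{ℓ+1};q)_n)/(q^n (1-q)^n (-q^{n+ℓ+1};q)_n) · Σ_{k=0}^n [(q^{-n};q)_k (-q^{n+ℓ+1};q)_k q^k / ((q;q)_k (q^{ℓ+1};q)_k)] · (q(1−(1−q)z);q)_k. Then P_{ℓ,0}(z) = 1, P_{ℓ,1}(z) = a_{ℓ,0} + z, and for n ≥ 1, P_{ℓ,n+1}(z) = (a_{ℓ,n}+z) P_{ℓ,n}(z) − b_{ℓ,n} P_{ℓ,n−1}(z), where a_{ℓ,n} = q^{2n+ℓ}(1+q)(1+q^ℓ)/((1−q)(1+q^{2n+ℓ})(1+q^{2n+ℓ+2})) − 1/(1−q) and b_{ℓ,n} = −q^{2n+2ℓ−1}(1−q^{2n})(1−q^{2n+2ℓ})/((1−q)^2 (1+q^{2n+ℓ−1})(1+q^{2n+ℓ})^2 (1+q^{2n+ℓ+1})). -/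

import Mathlib

open Finset Polynomial

noncomputable def q : RatFunc ℚ := RatFunc.X

/-- q-integer `[k]_q = (1-q^k)/(1-q)` for `k : ℤ`. -/
noncomputable def qint (k : ℤ) : RatFunc ℚ := (1 - q ^ k) / (1 - q)

/-- q-factorial `[n]_q!`. -/
noncomputable def qfact (n : ℕ) : RatFunc ℚ := ∏ m ∈ Finset.range n, qint (m + 1)

/-- q-Pochhammer `(A;Q)_n`. -/
noncomputable def qPoch (Q A : RatFunc ℚ) (n : ℕ) : RatFunc ℚ :=
  ∏ j ∈ Finset.range n, (1 - A * Q ^ j)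

/-- The generalized q-binomial polynomial `[m, z choose n]_q`. -/
noncomputable def qbinomPoly (m n : ℕ) : Polynomial (RatFunc ℚ) :=
  Polynomial.C (qfact n)⁻¹ *
    ∏ k ∈ Finset.Icc ((m : ℤ) - n + 1) (m : ℤ),
      (Polynomial.C (qint k) + Polynomial.C (q ^ k) * Polynomial.X)

/-- The polynomial `(q(1-(1-q)z); q)_k` in the variable `z`. -/
noncomputable def pochPoly (k : ℕ) : Polynomial (RatFunc ℚ) :=
  ∏ j ∈ Finset.range k,
    (1 - Polynomial.C q * (1 - Polynomial.C (1 - q) * Polynomial.X) * Polynomial.C q ^ j)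

/-- The specialized (rescaled, shifted) big q-Jacobi polynomials `P_{ℓ,n}(z)`. -/
noncomputable def bigP (ℓ n : ℕ) : Polynomial (RatFunc ℚ) :=
  Polynomial.C ((-1) ^ n * qPoch q (q ^ (ℓ + 1)) n /
      (q ^ n * (1 - q) ^ n * qPoch q (-q ^ (n + ℓ + 1)) n)) *
    ∑ k ∈ Finset.range (n + 1),
      Polynomial.C (qPoch q (q ^ (-(n : ℤ))) k * qPoch q (-q ^ (n + ℓ + 1)) k * q ^ k /
          (qPoch q q k * qPoch q (q ^ (ℓ + 1)) k)) * pochPoly k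

/-- The recursion coefficient `a_{ℓ,n}`. -/
noncomputable def aCoef (ℓ n : ℕ) : RatFunc ℚ :=
  q ^ (2 * n + ℓ) * (1 + q) * (1 + q ^ ℓ) /
      ((1 - q) * (1 + q ^ (2 * n + ℓ)) * (1 + q ^ (2 * n + ℓ + 2))) -
    1 / (1 - q)

/-- The recursion coefficient `b_{ℓ,n}`. -/
noncomputable def bCoef (ℓ n : ℕ) : RatFunc ℚ :=
  -(q ^ (2 * (n : ℤ) + 2 * (ℓ : ℤ) - 1) * (1 - q ^ (2 * n)) * (1 - q ^ (2 * n + 2 * ℓ)) /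
    ((1 - q) ^ 2 * (1 + q ^ (2 * (n : ℤ) + (ℓ : ℤ) - 1)) * (1 + q ^ (2 * n + ℓ)) ^ 2 *
      (1 + q ^ (2 * n + ℓ + 1))))

lemma q_ne_zero : q ≠ 0 := RatFunc.X_ne_zero

lemma one_sub_q_pow_ne_zero {n : ℕ} (hn : n ≠ 0) : 1 - q ^ n ≠ 0 := by
  intro h
  have h1 : (algebraMap ℚ[X] (RatFunc ℚ)) (X ^ n) = algebraMap ℚ[X] (RatFunc ℚ) 1 := by
    rw [map_pow, map_one, RatFunc.algebraMap_X]
    exact (sub_eq_zero.mp h).symm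
  have h2 := congrArg (Polynomial.eval 0) (RatFunc.algebraMap_injective ℚ h1)
  simp [hn] at h2

lemma one_add_q_pow_ne_zero (n : ℕ) : 1 + q ^ n ≠ 0 := by
  intro h
  have h1 : (algebraMap ℚ[X] (RatFunc ℚ)) (1 + X ^ n) = algebraMap ℚ[X] (RatFunc ℚ) 0 := by
    rw [map_add, map_pow, map_one, map_zero, RatFunc.algebraMap_X]
    exact h
  have h2 := congrArg (Polynomial.eval 1) (RatFunc.algebraMap_injective ℚ h1)
  norm_num at h2

lemma qPoch_succ (Q A : RatFunc ℚ) (n : ℕ) :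
    qPoch Q A (n + 1) = qPoch Q A n * (1 - A * Q ^ n) :=
  prod_range_succ _ _

lemma qPoch_shift (Q A : RatFunc ℚ) (n : ℕ) :
    (1 - A) * qPoch Q (A * Q) n = qPoch Q A n * (1 - A * Q ^ n) := by
  induction n with
  | zero => simp [qPoch]
  | succ n ih =>
    rw [qPoch_succ, qPoch_succ, ← mul_assoc, ih]
    ring

lemma qPoch_succ' (Q A : RatFunc ℚ) (n : ℕ) :
    qPoch Q A (n + 1) = (1 - A) * qPoch Q (A * Q) n := by
  rw [qPoch_shift, qPoch_succ]

lemma qPoch_neg_q_pow_ne_zero (m n : ℕ) : qPoch q (-q ^ m) n ≠ 0 := by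
  refine prod_ne_zero_iff.mpr fun j _ => ?_
  rw [neg_mul, sub_neg_eq_add, ← pow_add]
  exact one_add_q_pow_ne_zero _

/-- The normalizing factor of `bigP ℓ n`. -/
noncomputable def bigPNorm (ℓ n : ℕ) : RatFunc ℚ :=
  (-1) ^ n * qPoch q (q ^ (ℓ + 1)) n / (q ^ n * (1 - q) ^ n * qPoch q (-q ^ (n + ℓ + 1)) n)

/-- The coefficient of `pochPoly k` in the hypergeometric sum of `bigP ℓ n`. -/
noncomputable def bigPTerm (ℓ n k : ℕ) : RatFunc ℚ :=
  qPoch q (q ^ (-(n : ℤ))) k * qPoch q (-q ^ (n + ℓ + 1)) k * q ^ k /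
    (qPoch q q k * qPoch q (q ^ (ℓ + 1)) k)

lemma bigPTerm_zero (ℓ n : ℕ) : bigPTerm ℓ n 0 = 1 := by
  simp [bigPTerm, qPoch]

lemma bigPTerm_eq_zero {n k : ℕ} (ℓ : ℕ) (h : n < k) : bigPTerm ℓ n k = 0 := by
  have : qPoch q (q ^ (-(n : ℤ))) k = 0 :=
    prod_eq_zero (mem_range.mpr h) (by simp [q_ne_zero])
  rw [bigPTerm, this, zero_mul, zero_mul, zero_div]

lemma bigP_eq_sum {n m : ℕ} (ℓ : ℕ) (h : n < m) :
    bigP ℓ n = ∑ k ∈ range m, C (bigPNorm ℓ n * bigPTerm ℓ n k) * pochPoly k := by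
  have hsub : range (n + 1) ⊆ range m := range_subset_range.mpr h
  rw [← sum_subset hsub fun k _ hk => by
    rw [bigPTerm_eq_zero ℓ (by simpa using hk), mul_zero, C_0, zero_mul]]
  simp only [bigP, bigPNorm, bigPTerm, mul_sum, C_mul, mul_assoc]

lemma X_mul_pochPoly (k : ℕ) :
    X * pochPoly k = C ((1 - (q ^ (k + 1))⁻¹) / (1 - q)) * pochPoly k +
      C ((q ^ (k + 1))⁻¹ / (1 - q)) * pochPoly (k + 1) := by
  have hq := q_ne_zero
  have h1 : 1 - q ≠ 0 := by simpa using one_sub_q_pow_ne_zero one_ne_zero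
  have hs : pochPoly (k + 1) =
      pochPoly k * (C (1 - q ^ (k + 1)) + C (q ^ (k + 1) * (1 - q)) * X) := by
    rw [pochPoly, prod_range_succ, ← pochPoly]
    simp only [C_mul, C_sub, C_pow, C_1]
    ring
  have e0 : (1 - (q ^ (k + 1))⁻¹) / (1 - q) + (q ^ (k + 1))⁻¹ / (1 - q) * (1 - q ^ (k + 1)) =
      0 := by
    field_simp
    ring
  have e1 : (q ^ (k + 1))⁻¹ / (1 - q) * (q ^ (k + 1) * (1 - q)) = 1 := by
    field_simp
  have e0' := congrArg (C : RatFunc ℚ → (RatFunc ℚ)[X]) e0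
  have e1' := congrArg (C : RatFunc ℚ → (RatFunc ℚ)[X]) e1
  rw [C_add, C_mul, C_0] at e0'
  rw [C_mul, C_1] at e1'
  rw [hs]
  linear_combination (-pochPoly k) * e0' - (X * pochPoly k) * e1'

lemma bigPNorm_succ (ℓ n : ℕ) :
    bigPNorm ℓ (n + 1) = -bigPNorm ℓ n * ((1 - q ^ (ℓ + 1 + n)) * (1 + q ^ (n + ℓ + 1)) /
      (q * (1 - q) * (1 + q ^ (2 * n + ℓ + 1)) * (1 + q ^ (2 * n + ℓ + 2)))) := by
  have hq := q_ne_zero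
  have h1 : 1 - q ≠ 0 := by simpa using one_sub_q_pow_ne_zero one_ne_zero
  have hB := one_add_q_pow_ne_zero (n + ℓ + 1)
  have hB1 := one_add_q_pow_ne_zero (2 * n + ℓ + 1)
  have hB2 := one_add_q_pow_ne_zero (2 * n + ℓ + 2)
  have hP := qPoch_neg_q_pow_ne_zero (n + ℓ + 1) n
  have hs : qPoch q (-q ^ (n + 1 + ℓ + 1)) (n + 1) = qPoch q (-q ^ (n + ℓ + 1)) n *
      ((1 + q ^ (2 * n + ℓ + 1)) * (1 + q ^ (2 * n + ℓ + 2)) / (1 + q ^ (n + ℓ + 1))) := by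
    have h := qPoch_shift q (-q ^ (n + ℓ + 1)) (n + 1)
    rw [qPoch_succ q (-q ^ (n + ℓ + 1)) n,
      show -q ^ (n + ℓ + 1) * q = -q ^ (n + 1 + ℓ + 1) by ring] at h
    rw [← mul_div_assoc, eq_div_iff hB]
    linear_combination h
  rw [bigPNorm, bigPNorm, hs, qPoch_succ]
  field_simp
  ring

lemma bigPTerm_succ (ℓ n k : ℕ) :
    bigPTerm ℓ n (k + 1) = bigPTerm ℓ n k *
      ((1 - q ^ k / q ^ n) * (1 + q ^ (n + ℓ + 1) * q ^ k) * q /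
        ((1 - q ^ (k + 1)) * (1 - q ^ (ℓ + 1 + k)))) := by
  simp only [bigPTerm, qPoch_succ, zpow_neg, zpow_natCast, pow_add, div_eq_mul_inv, mul_inv]
  ring

lemma q_zpow_neg_succ_mul (n : ℕ) : q ^ (-((n + 1 : ℕ) : ℤ)) * q = q ^ (-(n : ℤ)) := by
  rw [← zpow_add_one₀ q_ne_zero]
  congr 1
  push_cast
  ring

lemma bigPTerm_succ_succ (ℓ n k : ℕ) :
    bigPTerm ℓ (n + 1) (k + 1) = bigPTerm ℓ n k *
      ((1 - 1 / q ^ (n + 1)) * (1 + q ^ (n + ℓ + 1) * q ^ k) *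
        (1 + q ^ (n + ℓ + 1) * q ^ (k + 1)) * q /
        ((1 + q ^ (n + ℓ + 1)) * (1 - q ^ (k + 1)) * (1 - q ^ (ℓ + 1 + k)))) := by
  have hB := one_add_q_pow_ne_zero (n + ℓ + 1)
  have hs : qPoch q (-q ^ (n + 1 + ℓ + 1)) (k + 1) = qPoch q (-q ^ (n + ℓ + 1)) k *
      ((1 + q ^ (n + ℓ + 1) * q ^ k) * (1 + q ^ (n + ℓ + 1) * q ^ (k + 1)) /
        (1 + q ^ (n + ℓ + 1))) := by
    have h := qPoch_shift q (-q ^ (n + ℓ + 1)) (k + 1)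
    rw [qPoch_succ q (-q ^ (n + ℓ + 1)) k,
      show -q ^ (n + ℓ + 1) * q = -q ^ (n + 1 + ℓ + 1) by ring] at h
    rw [← mul_div_assoc, eq_div_iff hB]
    linear_combination h
  rw [bigPTerm, bigPTerm, qPoch_succ' q (q ^ (-((n + 1 : ℕ) : ℤ))), q_zpow_neg_succ_mul, hs,
    qPoch_succ, qPoch_succ, zpow_neg, zpow_natCast]
  simp only [pow_add, div_eq_mul_inv, mul_inv]
  ring

lemma bigPTerm_pred_succ (ℓ n k : ℕ) :
    bigPTerm ℓ n (k + 1) = bigPTerm ℓ (n + 1) k *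
      ((1 - q ^ k / q ^ (n + 1)) * (1 - q ^ (k + 1) / q ^ (n + 1)) * (1 + q ^ (n + ℓ + 1)) * q /
        ((1 - 1 / q ^ (n + 1)) * (1 - q ^ (k + 1)) * (1 - q ^ (ℓ + 1 + k)))) := by
  have hn : 1 - 1 / q ^ (n + 1) ≠ 0 := by
    rw [one_sub_div (pow_ne_zero _ q_ne_zero), ← neg_sub, neg_div]
    exact neg_ne_zero.mpr
      (div_ne_zero (one_sub_q_pow_ne_zero n.succ_ne_zero) (pow_ne_zero _ q_ne_zero))
  have hs : qPoch q (q ^ (-(n : ℤ))) (k + 1) = qPoch q (q ^ (-((n + 1 : ℕ) : ℤ))) k *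
      ((1 - q ^ k / q ^ (n + 1)) * (1 - q ^ (k + 1) / q ^ (n + 1)) / (1 - 1 / q ^ (n + 1))) := by
    have h := qPoch_shift q (q ^ (-((n + 1 : ℕ) : ℤ))) (k + 1)
    rw [qPoch_succ q (q ^ (-((n + 1 : ℕ) : ℤ))) k, q_zpow_neg_succ_mul] at h
    rw [← mul_div_assoc, eq_div_iff hn]
    rw [zpow_neg q ((n + 1 : ℕ) : ℤ), zpow_natCast] at h ⊢
    linear_combination h
  rw [bigPTerm, bigPTerm, hs, qPoch_succ' q (-q ^ (n + ℓ + 1)),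
    show -q ^ (n + ℓ + 1) * q = -q ^ (n + 1 + ℓ + 1) by ring, qPoch_succ, qPoch_succ]
  simp only [pow_add, div_eq_mul_inv, mul_inv]
  ring

lemma bCoef_succ (ℓ m : ℕ) :
    bCoef ℓ (m + 1) = -(q ^ (2 * m + 2 * ℓ + 1) * (1 - q ^ (2 * m + 2)) *
      (1 - q ^ (2 * m + 2 * ℓ + 2)) / ((1 - q) ^ 2 * (1 + q ^ (2 * m + ℓ + 1)) *
        (1 + q ^ (2 * m + ℓ + 2)) ^ 2 * (1 + q ^ (2 * m + ℓ + 3)))) := by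
  have h1 : 2 * ((m + 1 : ℕ) : ℤ) + 2 * (ℓ : ℤ) - 1 = (2 * m + 2 * ℓ + 1 : ℕ) := by
    push_cast
    ring
  have h2 : 2 * ((m + 1 : ℕ) : ℤ) + (ℓ : ℤ) - 1 = (2 * m + ℓ + 1 : ℕ) := by
    push_cast
    ring
  rw [bCoef, h1, h2, zpow_natCast, zpow_natCast]
  ring_nf

lemma aCoef_succ (ℓ m : ℕ) :
    aCoef ℓ (m + 1) = q ^ (2 * m + ℓ + 2) * (1 + q) * (1 + q ^ ℓ) /
      ((1 - q) * (1 + q ^ (2 * m + ℓ + 2)) * (1 + q ^ (2 * m + ℓ + 4))) - 1 / (1 - q) := by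
  rw [aCoef, show 2 * (m + 1) + ℓ = 2 * m + ℓ + 2 by ring]

lemma bigPNorm_recurrence (ℓ m : ℕ) :
    bigPNorm ℓ (m + 2) =
      (aCoef ℓ (m + 1) + (1 - (q ^ (0 + 1))⁻¹) / (1 - q)) * bigPNorm ℓ (m + 1) -
        bCoef ℓ (m + 1) * bigPNorm ℓ m := by
  have hq := q_ne_zero
  have h1 : 1 - q ≠ 0 := by simpa using one_sub_q_pow_ne_zero one_ne_zero
  have hB1 := one_add_q_pow_ne_zero (2 * m + ℓ + 1)
  have hB2 := one_add_q_pow_ne_zero (2 * m + ℓ + 2)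
  have hB3 := one_add_q_pow_ne_zero (2 * m + ℓ + 3)
  have hB4 := one_add_q_pow_ne_zero (2 * m + ℓ + 4)
  rw [bigPNorm_succ ℓ (m + 1), bigPNorm_succ ℓ m, bCoef_succ, aCoef_succ,
    show 2 * (m + 1) + ℓ + 1 = 2 * m + ℓ + 3 by ring,
    show 2 * (m + 1) + ℓ + 2 = 2 * m + ℓ + 4 by ring,
    show m + 1 + ℓ + 1 = m + ℓ + 2 by ring]
  simp only [pow_add, pow_mul', pow_one, zero_add] at *
  generalize q ^ m = M at *
  generalize q ^ ℓ = L at *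
  -- `field_simp` recognizes the nonzero denominators only as atoms
  generalize hD1 : 1 + M ^ 2 * L * q = D1 at *
  generalize hD2 : 1 + M ^ 2 * L * q ^ 2 = D2 at *
  generalize hD3 : 1 + M ^ 2 * L * q ^ 3 = D3 at *
  generalize hD4 : 1 + M ^ 2 * L * q ^ 4 = D4 at *
  field_simp
  subst hD1 hD2 hD3 hD4
  ring

lemma bigP_coeff_recurrence (ℓ m k : ℕ) :
    bigPNorm ℓ (m + 2) * bigPTerm ℓ (m + 2) (k + 1) =
      (aCoef ℓ (m + 1) + (1 - (q ^ (k + 1 + 1))⁻¹) / (1 - q)) *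
          (bigPNorm ℓ (m + 1) * bigPTerm ℓ (m + 1) (k + 1)) +
        (q ^ (k + 1))⁻¹ / (1 - q) * (bigPNorm ℓ (m + 1) * bigPTerm ℓ (m + 1) k) -
        bCoef ℓ (m + 1) * (bigPNorm ℓ m * bigPTerm ℓ m (k + 1)) := by
  have hq := q_ne_zero
  have h1 : 1 - q ≠ 0 := by simpa using one_sub_q_pow_ne_zero one_ne_zero
  have hB0 := one_add_q_pow_ne_zero (m + ℓ + 2)
  have hB1 := one_add_q_pow_ne_zero (2 * m + ℓ + 1)
  have hB2 := one_add_q_pow_ne_zero (2 * m + ℓ + 2)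
  have hB3 := one_add_q_pow_ne_zero (2 * m + ℓ + 3)
  have hB4 := one_add_q_pow_ne_zero (2 * m + ℓ + 4)
  have hk := one_sub_q_pow_ne_zero (n := k + 1) (by lia)
  have hl := one_sub_q_pow_ne_zero (n := ℓ + 1 + k) (by lia)
  have hm := sub_ne_zero.mpr (sub_ne_zero.mp (one_sub_q_pow_ne_zero (n := m + 1) (by lia))).symm
  have hM : q ^ m ≠ 0 := pow_ne_zero _ hq
  have hK : q ^ k ≠ 0 := pow_ne_zero _ hq
  rw [bigPTerm_succ_succ ℓ (m + 1), bigPTerm_succ ℓ (m + 1), bigPTerm_pred_succ ℓ m,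
    bigPNorm_succ ℓ (m + 1), bigPNorm_succ ℓ m, bCoef_succ, aCoef_succ,
    show 2 * (m + 1) + ℓ + 1 = 2 * m + ℓ + 3 by ring,
    show 2 * (m + 1) + ℓ + 2 = 2 * m + ℓ + 4 by ring,
    show m + 1 + ℓ + 1 = m + ℓ + 2 by ring]
  generalize bigPTerm ℓ (m + 1) k = t
  generalize bigPNorm ℓ m = N
  simp only [pow_add, pow_mul', pow_one] at *
  rw [mul_comm] at hm
  generalize q ^ m = M at *
  generalize q ^ ℓ = L at *
  generalize q ^ k = K at *
  generalize hD1 : 1 + M ^ 2 * L * q = D1 at *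
  generalize hD2 : 1 + M ^ 2 * L * q ^ 2 = D2 at *
  generalize hD3 : 1 + M ^ 2 * L * q ^ 3 = D3 at *
  generalize hD4 : 1 + M ^ 2 * L * q ^ 4 = D4 at *
  generalize hE : 1 + M * L * q ^ 2 = E at *
  generalize hF : 1 - K * q = F at *
  generalize hG : 1 - L * q * K = G at *
  field_simp
  subst hD1 hD2 hD3 hD4 hE hF hG
  ring

lemma bigP_one (ℓ : ℕ) : bigP ℓ 1 = C (aCoef ℓ 0) + X := by
  have hq := q_ne_zero
  have h1 : 1 - q ≠ 0 := by simpa using one_sub_q_pow_ne_zero one_ne_zero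
  have hB0 := one_add_q_pow_ne_zero ℓ
  have hB1 := one_add_q_pow_ne_zero (ℓ + 1)
  have hB2 := one_add_q_pow_ne_zero (ℓ + 2)
  have hl : 1 - q ^ (ℓ + 1) ≠ 0 := one_sub_q_pow_ne_zero ℓ.succ_ne_zero
  have hN : bigPNorm ℓ 1 = -((1 - q ^ (ℓ + 1)) / (q * (1 - q) * (1 + q ^ (ℓ + 2)))) := by
    rw [bigPNorm_succ ℓ 0]
    simp only [bigPNorm, qPoch, range_zero, prod_empty, pow_zero, mul_zero, zero_add, add_zero,
      mul_one, div_one]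
    field_simp
  have hT : bigPTerm ℓ 1 1 = -((1 + q ^ (ℓ + 2)) / (1 - q ^ (ℓ + 1))) := by
    rw [bigPTerm_succ ℓ 1 0, bigPTerm_zero, show 1 + ℓ + 1 = ℓ + 2 by ring]
    simp only [pow_zero, zero_add, add_zero, mul_one, pow_one, one_mul]
    field_simp
    ring
  have hp : pochPoly 1 = C (1 - q) + C (q * (1 - q)) * X := by
    simp only [pochPoly, prod_range_one, pow_zero, mul_one, C_mul, C_sub, C_1]
    ring
  have e0 : bigPNorm ℓ 1 + bigPNorm ℓ 1 * bigPTerm ℓ 1 1 * (1 - q) = aCoef ℓ 0 := by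
    rw [hN, hT, aCoef]
    simp only [mul_zero, zero_add, pow_add, pow_one] at *
    generalize q ^ ℓ = L at *
    field_simp
    ring
  have e1 : bigPNorm ℓ 1 * bigPTerm ℓ 1 1 * (q * (1 - q)) = 1 := by
    rw [hN, hT]
    field_simp
  rw [bigP_eq_sum ℓ (Nat.lt_succ_self 1), sum_range_succ, sum_range_one, bigPTerm_zero, mul_one, hp,
    show pochPoly 0 = 1 from prod_range_zero _, mul_one, mul_add, ← mul_assoc, ← C_mul, ← C_mul,
    ← add_assoc, ← C_add, e0, e1, C_1, one_mul]

theorem bigP_three_term_recurrence (ℓ : ℕ) :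
    bigP ℓ 0 = 1 ∧
    bigP ℓ 1 = Polynomial.C (aCoef ℓ 0) + Polynomial.X ∧
    ∀ n : ℕ, 1 ≤ n →
      bigP ℓ (n + 1) =
        (Polynomial.C (aCoef ℓ n) + Polynomial.X) * bigP ℓ n -
          Polynomial.C (bCoef ℓ n) * bigP ℓ (n - 1) := by
  refine ⟨by simp [bigP, qPoch, pochPoly], bigP_one ℓ, fun n hn => ?_⟩
  obtain ⟨m, rfl⟩ := Nat.exists_eq_add_of_le' hn
  rw [Nat.add_sub_cancel]
  have hX : X * bigP ℓ (m + 1) =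
      ∑ k ∈ range (m + 3), C ((1 - (q ^ (k + 1))⁻¹) / (1 - q) *
        (bigPNorm ℓ (m + 1) * bigPTerm ℓ (m + 1) k)) * pochPoly k +
      ∑ k ∈ range (m + 2), C ((q ^ (k + 1))⁻¹ / (1 - q) *
        (bigPNorm ℓ (m + 1) * bigPTerm ℓ (m + 1) k)) * pochPoly (k + 1) := by
    rw [sum_range_succ, bigPTerm_eq_zero ℓ (by lia : m + 1 < m + 2), mul_zero, mul_zero, C_0,
      zero_mul, add_zero, ← sum_add_distrib, bigP_eq_sum ℓ (by lia : m + 1 < m + 2), mul_sum]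
    refine sum_congr rfl fun k _ => ?_
    rw [mul_left_comm, X_mul_pochPoly]
    simp only [C_mul]
    ring
  rw [add_mul, hX, bigP_eq_sum ℓ (by lia : m + 2 < m + 3),
    bigP_eq_sum ℓ (by lia : m + 1 < m + 3), bigP_eq_sum ℓ (by lia : m < m + 3)]
  simp only [sum_range_succ' _ (m + 2), bigPTerm_zero, mul_one, bigP_coeff_recurrence]
  rw [bigPNorm_recurrence]
  simp only [C_add, C_sub, C_mul, add_mul, sub_mul, sum_add_distrib,
    sum_sub_distrib, mul_sum, mul_add, mul_assoc]
  ring
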